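/- arXiv:1505.04934 — 4 statements merged into one kernel-verified Lean document; each statement's English description precedes it below -/
import Mathlib

section
/- Let M be a monoid and n ≥ 1 a natural number such that for all u, v ∈ M one has (u*v)^n * v * (u*v)^n = (u*v)^n. Then for all v, u, u', w, w' ∈ M satisfying v*u*w = v and v*u'*w' = v, one has v * u * u' * (w' * u * (w*u'*w'*u)^n * w) = v. Consequently, if S is a submonoid of M and u, u', w, w' all belong to S, then there exists w'' ∈ S with v * u * u' * w'' = v. -/
/-- A right stabilizer of `x` also fixes `x` when raised to any power. -/
theorem mul_pow_eq_self_of_mul_eq_self {M : Type*} [Monoid M] {x a : M} (h : x * a = x) (k : ℕ) :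
    x * a ^ k = x := by
  induction k with
  | zero => simp
  | succ k ih => rw [pow_succ, ← mul_assoc, ih, h]

/-- In a monoid satisfying `(u*v)^n * v * (u*v)^n = (u*v)^n` for all `u, v`
(with `n ≥ 1`), if `v*u*w = v` and `v*u'*w' = v` then
`v * u * u' * (w' * u * (w*u'*w'*u)^n * w) = v`; consequently, if `u, u', w, w'` lie
in a submonoid `S`, there exists `w'' ∈ S` with `v * u * u' * w'' = v`. -/
theorem stmt0 {M : Type*} [Monoid M] (n : ℕ) (hn : 1 ≤ n)
    (hid : ∀ u v : M, (u * v) ^ n * v * (u * v) ^ n = (u * v) ^ n) :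
    (∀ v u u' w w' : M, v * u * w = v → v * u' * w' = v →
      v * u * u' * (w' * u * (w * u' * w' * u) ^ n * w) = v) ∧
    (∀ (S : Submonoid M) (v u u' w w' : M), u ∈ S → u' ∈ S → w ∈ S → w' ∈ S →
      v * u * w = v → v * u' * w' = v →
      ∃ w'' ∈ S, v * u * u' * w'' = v) := by
  have key : ∀ v u u' w w' : M, v * u * w = v → v * u' * w' = v →
      v * u * u' * (w' * u * (w * u' * w' * u) ^ n * w) = v := by
    intro v u u' w w' h h'
    have hfix : v * u * (w * u' * w' * u) ^ n = v * u :=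
      mul_pow_eq_self_of_mul_eq_self (by simp only [← mul_assoc, h, h']) n
    have he := hid w (u' * w' * u)
    simp only [← mul_assoc] at he
    calc v * u * u' * (w' * u * (w * u' * w' * u) ^ n * w)
        = v * u * (w * u' * w' * u) ^ n * u' * (w' * u * (w * u' * w' * u) ^ n * w) := by rw [hfix]
      _ = v * u * ((w * u' * w' * u) ^ n * u' * w' * u * (w * u' * w' * u) ^ n) * w := by
          simp only [mul_assoc]
      _ = v := by rw [he, hfix, h]
  refine ⟨key, fun S v u u' w w' hu hu' hw hw' h h' => ⟨_, ?_, key v u u' w w' h h'⟩⟩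
  exact S.mul_mem (S.mul_mem (S.mul_mem hw' hu)
    (S.pow_mem (S.mul_mem (S.mul_mem (S.mul_mem hw hu') hw') hu) n)) hw
end

section
/- Let M be a monoid acting on a type H by a multiplicative action, and let n ≥ 1 be a natural number such that for all u, v ∈ M one has (u*v)^n * v * (u*v)^n = (u*v)^n. Then for all a, b, c ∈ M and h ∈ H: if (a*b*c) • h = h, then ((a*b*c)^n * a * b) • h = h. -/
/-- The identity `(uv)ⁿ v (uv)ⁿ = (uv)ⁿ` forces aperiodicity. -/
theorem pow_mul_self_of_pow_mul_mul_pow {M : Type*} [Monoid M] {n : ℕ}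
    (hid : ∀ u v : M, (u * v) ^ n * v * (u * v) ^ n = (u * v) ^ n) (x : M) :
    x ^ n * x = x ^ n := by
  have hidem : x ^ n * x ^ n = x ^ n := by simpa using hid x 1
  have habs : x ^ n * x * x ^ n = x ^ n := by simpa using hid 1 x
  rwa [mul_assoc, (Commute.self_pow x n).eq, ← mul_assoc, hidem] at habs

/-- The identity `(uv)ⁿ v (uv)ⁿ = (uv)ⁿ` implies its dual, in which the left factor is absorbed. -/
theorem pow_mul_left_mul_pow_of_pow_mul_mul_pow {M : Type*} [Monoid M] {n : ℕ}
    (hid : ∀ u v : M, (u * v) ^ n * v * (u * v) ^ n = (u * v) ^ n) (x y : M) :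
    (x * y) ^ n * x * (x * y) ^ n = (x * y) ^ n := by
  have hconj : (x * y) ^ n * x = x * (y * x) ^ n :=
    (SemiconjBy.pow_right (mul_assoc x y x).symm n).eq.symm
  have hfactor : (x * y) ^ n = x * (y * x) ^ n * y := by
    rw [← hconj, mul_assoc, pow_mul_self_of_pow_mul_mul_pow hid]
  calc (x * y) ^ n * x * (x * y) ^ n
      = x * ((y * x) ^ n * x * (y * x) ^ n) * y := by
        rw [hconj, hfactor]; simp only [mul_assoc]
    _ = (x * y) ^ n := by rw [hid, hfactor]

/-- If a monoid `M` acting on `H` satisfies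
`(u*v)^n * v * (u*v)^n = (u*v)^n` for all `u, v` (with `n ≥ 1`), then for all
`a, b, c ∈ M` and `h ∈ H`, `(a*b*c) • h = h` implies `((a*b*c)^n * a * b) • h = h`. -/
theorem stmt1 {M H : Type*} [Monoid M] [MulAction M H] (n : ℕ) (hn : 1 ≤ n)
    (hid : ∀ u v : M, (u * v) ^ n * v * (u * v) ^ n = (u * v) ^ n)
    (a b c : M) (h : H) (hfix : (a * b * c) • h = h) :
    ((a * b * c) ^ n * a * b) • h = h := by
  have hpow : (a * b * c) ^ n • h = h := by
    rw [← smul_iterate_apply]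
    exact Function.iterate_fixed hfix n
  have hdual := congrArg (· • h) (pow_mul_left_mul_pow_of_pow_mul_mul_pow hid (a * b) c)
  simpa only [mul_smul _ ((a * b * c) ^ n) h, hpow, ← mul_assoc] using hdual
end

section
/- Let M be a monoid acting on a type H by a multiplicative action, let n ≥ 1 be a natural number such that for all u, v ∈ M one has (u*v)^n * v * (u*v)^n = (u*v)^n, and let S be a submonoid of M. For h, h' ∈ H write h ≼ h' if there exists s ∈ S with h = s • h'. Suppose h ≼ h' and h' ≼ h (h and h' are mutually reachable through S), and suppose u ∈ S satisfies h ≼ u • h, i.e. there is w ∈ S with w • (u • h) = h. Then h' ≼ u • h', i.e. there exists w' ∈ S with w' • (u • h') = h'. -/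
/-- Let `M` be a monoid acting on `H` satisfying
`(u*v)^n * v * (u*v)^n = (u*v)^n` for all `u, v` (with `n ≥ 1`), and let `S` be a
submonoid of `M`. Write `h ≼ h'` if `h = s • h'` for some `s ∈ S`. If `h ≼ h'`,
`h' ≼ h`, `u ∈ S` and there is `w ∈ S` with `w • (u • h) = h`, then there exists
`w' ∈ S` with `w' • (u • h') = h'`. -/
theorem stmt2 {M H : Type*} [Monoid M] [MulAction M H] (n : ℕ) (hn : 1 ≤ n)
    (hid : ∀ u v : M, (u * v) ^ n * v * (u * v) ^ n = (u * v) ^ n)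
    (S : Submonoid M) (h h' : H) (u : M) (hu : u ∈ S)
    (h1 : ∃ s ∈ S, h = s • h') (h2 : ∃ s ∈ S, h' = s • h)
    (h3 : ∃ w ∈ S, w • (u • h) = h) :
    ∃ w' ∈ S, w' • (u • h') = h' := by
  obtain ⟨s, hs, hsh⟩ := h1
  obtain ⟨t, ht, hth⟩ := h2
  obtain ⟨w, hw, hwu⟩ := h3
  obtain ⟨m, rfl⟩ : ∃ m, n = m + 1 := ⟨n - 1, by omega⟩
  have hv : (t * w * u) • h = h' := by rw [mul_smul, mul_smul, hwu, ← hth]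
  have hk : s * (t * w * u) ∈ MulAction.stabilizerSubmonoid M h := by
    rw [MulAction.mem_stabilizerSubmonoid_iff, mul_smul, hv, ← hsh]
  have hpow : (s * (t * w * u)) ^ (m + 1) • h = h := pow_mem hk (m + 1)
  have key : (s * (t * w * u)) ^ (m + 1) • h' = h := by
    have hh := congrArg (· • h) (hid s (t * w * u))
    rwa [mul_smul, hpow, mul_smul, hv] at hh
  refine ⟨t * (s * (t * w * u)) ^ m * (s * (t * w)), ?_, ?_⟩
  · have htw := S.mul_mem ht hw
    exact S.mul_mem (S.mul_mem ht (S.pow_mem (S.mul_mem hs (S.mul_mem htw hu)) m))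
      (S.mul_mem hs htw)
  · calc (t * (s * (t * w * u)) ^ m * (s * (t * w))) • u • h'
        = t • (s * (t * w * u)) ^ (m + 1) • h' := by
          simp only [← mul_smul, pow_succ, mul_assoc]
      _ = h' := by rw [key, ← hth]
end

section
/- Let H be a commutative semigroup, written additively, such that h + h + h = h + h for all h ∈ H. Let l₁ and l₂ be nonempty lists of elements of H such that for every element a of H, the minimum of 2 and the number of occurrences of a in l₁ equals the minimum of 2 and the number of occurrences of a in l₂ (i.e. the lists contain the same elements with the same multiplicities counted up to threshold 2). Then the sums of l₁ and l₂ are equal, where the sum of a nonempty list [a₀, a₁, …, a_k] means a₀ + a₁ + ⋯ + a_k. -/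
/-- The sum `a₀ + a₁ + ⋯ + a_k` of a nonempty list with head `a` and tail `l`. -/
def listSum1 {H : Type*} [Add H] (a : H) (l : List H) : H :=
  l.foldl (· + ·) a

/-- In an additive monoid, if `x + x + x = x + x`, multiples of `x` only depend on the
multiplicity up to threshold 2. -/
theorem min_two_nsmul {M : Type*} [AddMonoid M] {x : M} (hx : x + x + x = x + x) (n : ℕ) :
    min 2 n • x = n • x := by
  induction n with
  | zero => simp
  | succ n ih =>
    rcases Nat.lt_or_ge n 2 with hn | hn
    · rw [min_eq_right (by omega)]
    · rw [succ_nsmul, ← ih, min_eq_left (by omega), min_eq_left hn, two_nsmul, hx]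

/-- In an additive commutative monoid, the sum of a list of values satisfying
`x + x + x = x + x` only depends on the multiplicities up to threshold 2. -/
theorem List.sum_map_eq_of_min_two_count_eq {α M : Type*} [DecidableEq α] [AddCommMonoid M]
    {f : α → M} (hf : ∀ a, f a + f a + f a = f a + f a) {l₁ l₂ : List α}
    (h : ∀ a, min 2 (l₁.count a) = min 2 (l₂.count a)) :
    (l₁.map f).sum = (l₂.map f).sum := by
  have hs : l₁.toFinset = l₂.toFinset := by
    ext a
    have := h a
    rw [List.mem_toFinset, List.mem_toFinset, ← List.count_pos_iff, ← List.count_pos_iff]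
    omega
  rw [Finset.sum_list_map_count, Finset.sum_list_map_count, hs]
  refine Finset.sum_congr rfl fun a _ => ?_
  rw [← min_two_nsmul (hf a), h a, min_two_nsmul (hf a)]

theorem coe_listSum1 {H : Type*} [AddSemigroup H] (a : H) (l : List H) :
    ((listSum1 a l : H) : WithZero H) = ((a :: l).map ((↑) : H → WithZero H)).sum := by
  induction l generalizing a with
  | nil => simp [listSum1]
  | cons b l ih =>
    have h : listSum1 a (b :: l) = listSum1 (a + b) l := rfl
    rw [h, ih]
    simp [WithZero.coe_add, add_assoc]

/-- In a commutative semigroup satisfying `h + h + h = h + h`, two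
nonempty lists containing the same elements with the same multiplicities counted
up to threshold 2 have equal sums. -/
theorem stmt4 {H : Type*} [AddCommSemigroup H] [DecidableEq H]
    (hidem : ∀ h : H, h + h + h = h + h)
    (a₁ a₂ : H) (l₁ l₂ : List H)
    (hcount : ∀ x : H, min 2 ((a₁ :: l₁).count x) = min 2 ((a₂ :: l₂).count x)) :
    listSum1 a₁ l₁ = listSum1 a₂ l₂ := by
  apply WithZero.coe_injective
  rw [coe_listSum1, coe_listSum1]
  refine List.sum_map_eq_of_min_two_count_eq (fun a => ?_) hcount
  rw [← WithZero.coe_add, ← WithZero.coe_add, hidem]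
end
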